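/- (Linear convergence of CoCoA for strongly convex regularizers.) Suppose each g_i is in addition μ-strongly convex with μ > 0, σ > 0 is compatible with the partition (‖Ax‖² ≤ σ Σ_{k=1}^K ‖A x_[k]‖² for all x), c_A > 0 satisfies ‖Ax‖² ≤ c_A ‖x‖² for all x ∈ ℝ^n, and F attains its minimum value F*. Let (α^(t))_{t≥0} be a CoCoA sequence with approximation quality θ ∈ (0,1]. Then the suboptimality ε^(t) := F(α^(t)) − F* satisfies ε^(t) ≤ (1 − (1−θ)·μ/(μ + σβ c_A))^t · ε^(0) for every t ≥ 0. -/

import Mathlib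

open RealInnerProductSpace Finset

noncomputable section

/-- Matrix–vector product `A x` viewed as a map between Euclidean spaces. -/
def mulVecE {d n : ℕ} (A : Matrix (Fin d) (Fin n) ℝ) (x : EuclideanSpace ℝ (Fin n)) :
    EuclideanSpace ℝ (Fin d) :=
  (WithLp.equiv 2 _).symm (A.mulVec ((WithLp.equiv 2 _) x))

/-- `restr I x` (written `x_[k]` in the paper) equals `x` on the coordinates in `I`
and is zero elsewhere. -/
def restr {n : ℕ} (I : Finset (Fin n)) (x : EuclideanSpace ℝ (Fin n)) :
    EuclideanSpace ℝ (Fin n) :=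
  (WithLp.equiv 2 _).symm (fun i => if i ∈ I then x i else 0)

/-- The global objective `F(α) = f(Aα) + ∑ i g i (α i)`. -/
def objF {d n : ℕ} (A : Matrix (Fin d) (Fin n) ℝ) (f : EuclideanSpace ℝ (Fin d) → ℝ)
    (g : Fin n → ℝ → ℝ) (α : EuclideanSpace ℝ (Fin n)) : ℝ :=
  f (mulVecE A α) + ∑ i, g i (α i)

/-- The CoCoA local subproblem objective
`F_σ^{(k)}(Δ; α, v) = (1/K) f(v) + ⟨∇f(v), AΔ⟩ + (σβ/2)‖AΔ‖² + ∑_{i ∈ I_k} g i (α i + Δ i)`,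
where `v = Aα` and `f'` is the gradient of `f`. -/
def locF {d n : ℕ} (A : Matrix (Fin d) (Fin n) ℝ) (f : EuclideanSpace ℝ (Fin d) → ℝ)
    (f' : EuclideanSpace ℝ (Fin d) → EuclideanSpace ℝ (Fin d))
    (g : Fin n → ℝ → ℝ) (K : ℕ) (σ β : ℝ) (Ik : Finset (Fin n))
    (α Δ : EuclideanSpace ℝ (Fin n)) : ℝ :=
  (1 / (K : ℝ)) * f (mulVecE A α) + ⟪f' (mulVecE A α), mulVecE A Δ⟫
    + σ * β / 2 * ‖mulVecE A Δ‖ ^ 2 + ∑ i ∈ Ik, g i (α i + Δ i)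

/-- Infimum of the local subproblem objective over vectors supported on `Ik`. -/
def locInf {d n : ℕ} (A : Matrix (Fin d) (Fin n) ℝ) (f : EuclideanSpace ℝ (Fin d) → ℝ)
    (f' : EuclideanSpace ℝ (Fin d) → EuclideanSpace ℝ (Fin d))
    (g : Fin n → ℝ → ℝ) (K : ℕ) (σ β : ℝ) (Ik : Finset (Fin n))
    (α : EuclideanSpace ℝ (Fin n)) : ℝ :=
  sInf ((locF A f f' g K σ β Ik α) '' {Δ | ∀ i ∉ Ik, Δ i = 0})

/-- `Δk` is a θ-approximate solution of the `k`-th local subproblem at `α`. -/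
def IsApprox {d n : ℕ} (A : Matrix (Fin d) (Fin n) ℝ) (f : EuclideanSpace ℝ (Fin d) → ℝ)
    (f' : EuclideanSpace ℝ (Fin d) → EuclideanSpace ℝ (Fin d))
    (g : Fin n → ℝ → ℝ) (K : ℕ) (σ β θ : ℝ) (Ik : Finset (Fin n))
    (α Δk : EuclideanSpace ℝ (Fin n)) : Prop :=
  (∀ i ∉ Ik, Δk i = 0) ∧
    locF A f f' g K σ β Ik α Δk - locInf A f f' g K σ β Ik α ≤
      θ * (locF A f f' g K σ β Ik α 0 - locInf A f f' g K σ β Ik α)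

theorem mulVecE_eq_toLpLin {d n : ℕ} (A : Matrix (Fin d) (Fin n) ℝ)
    (x : EuclideanSpace ℝ (Fin n)) : mulVecE A x = Matrix.toLpLin 2 2 A x := rfl

theorem restr_apply {n : ℕ} (J : Finset (Fin n)) (x : EuclideanSpace ℝ (Fin n)) (i : Fin n) :
    restr J x i = if i ∈ J then x i else 0 := rfl

/-- First-order characterization of convexity. -/
theorem ConvexOn.add_inner_gradient_le {E : Type*} [NormedAddCommGroup E]
    [InnerProductSpace ℝ E] [CompleteSpace E] {f : E → ℝ} (hf : ConvexOn ℝ Set.univ f)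
    {u f' : E} (hgrad : HasGradientAt f f' u) (w : E) :
    f u + ⟪f', w - u⟫ ≤ f w := by
  have hconv : ConvexOn ℝ Set.univ (f ∘ AffineMap.lineMap (k := ℝ) u w) :=
    hf.comp_affineMap _
  have hline : HasDerivAt (AffineMap.lineMap (k := ℝ) u w) (w - u) (0 : ℝ) :=
    AffineMap.hasDerivAt_lineMap
  have hderiv : HasDerivAt (f ∘ AffineMap.lineMap (k := ℝ) u w) ⟪f', w - u⟫ (0 : ℝ) := by
    have h0 : HasFDerivAt f (InnerProductSpace.toDual ℝ E f')
        (AffineMap.lineMap (k := ℝ) u w (0 : ℝ)) := by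
      simpa using hgrad.hasFDerivAt
    simpa using h0.comp_hasDerivAt (0 : ℝ) hline
  have h := hconv.le_slope_of_hasDerivAt (Set.mem_univ 0) (Set.mem_univ 1) one_pos hderiv
  simp [slope_def_field] at h
  linarith

section Partition

variable {n K : ℕ} {I : Fin K → Finset (Fin n)}

theorem sum_sum_of_partition (hdisj : ∀ k l, k ≠ l → Disjoint (I k) (I l))
    (hcover : ∀ i, ∃ k, i ∈ I k) (φ : Fin n → ℝ) :
    ∑ k, ∑ i ∈ I k, φ i = ∑ i, φ i := by
  rw [← Finset.sum_biUnion fun k _ l _ hkl => hdisj k l hkl]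
  congr 1
  ext i
  simpa using hcover i

theorem sum_apply_of_mem (hdisj : ∀ k l, k ≠ l → Disjoint (I k) (I l))
    {D : Fin K → EuclideanSpace ℝ (Fin n)} (hD : ∀ k, ∀ i ∉ I k, D k i = 0)
    {k : Fin K} {i : Fin n} (hi : i ∈ I k) : (∑ l, D l) i = D k i := by
  rw [WithLp.ofLp_sum, Finset.sum_apply]
  refine Finset.sum_eq_single_of_mem k (Finset.mem_univ k) fun l _ hl => hD l i fun hil => ?_
  exact Finset.disjoint_left.mp (hdisj l k hl) hil hi

theorem restr_sum (hdisj : ∀ k l, k ≠ l → Disjoint (I k) (I l))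
    {D : Fin K → EuclideanSpace ℝ (Fin n)} (hD : ∀ k, ∀ i ∉ I k, D k i = 0) (k : Fin K) :
    restr (I k) (∑ l, D l) = D k := by
  ext i
  rw [restr_apply]
  split_ifs with hi
  · exact sum_apply_of_mem hdisj hD hi
  · exact (hD k i hi).symm

theorem sum_restr (hdisj : ∀ k l, k ≠ l → Disjoint (I k) (I l))
    (hcover : ∀ i, ∃ k, i ∈ I k) (x : EuclideanSpace ℝ (Fin n)) :
    ∑ k, restr (I k) x = x := by
  ext i
  obtain ⟨k, hk⟩ := hcover i
  rw [sum_apply_of_mem hdisj (fun l j hj => by simp [restr_apply, hj]) hk]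
  simp [restr_apply, hk]

theorem sum_norm_sq_restr (hdisj : ∀ k l, k ≠ l → Disjoint (I k) (I l))
    (hcover : ∀ i, ∃ k, i ∈ I k) (x : EuclideanSpace ℝ (Fin n)) :
    ∑ k, ‖restr (I k) x‖ ^ 2 = ‖x‖ ^ 2 := by
  simp_rw [EuclideanSpace.real_norm_sq_eq, ← sum_sum_of_partition hdisj hcover fun i => x i ^ 2]
  refine Finset.sum_congr rfl fun k _ => ?_
  simp [restr_apply, ite_pow, Finset.sum_ite_mem]

end Partition

section CoCoA

variable {d n K : ℕ} {A : Matrix (Fin d) (Fin n) ℝ} {f : EuclideanSpace ℝ (Fin d) → ℝ}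
  {f' : EuclideanSpace ℝ (Fin d) → EuclideanSpace ℝ (Fin d)} {g : Fin n → ℝ → ℝ}
  {I : Fin K → Finset (Fin n)} {σ β μ cA : ℝ}

/-- The local objectives of blockwise supported updates sum to the quadratic model of the
global objective. -/
theorem sum_locF (hK : K ≠ 0) (hdisj : ∀ k l, k ≠ l → Disjoint (I k) (I l))
    (hcover : ∀ i, ∃ k, i ∈ I k) (a : EuclideanSpace ℝ (Fin n))
    {D : Fin K → EuclideanSpace ℝ (Fin n)} (hD : ∀ k, ∀ i ∉ I k, D k i = 0) :
    ∑ k, locF A f f' g K σ β (I k) a (D k) =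
      f (mulVecE A a) + ⟪f' (mulVecE A a), mulVecE A (∑ k, D k)⟫
        + σ * β / 2 * ∑ k, ‖mulVecE A (D k)‖ ^ 2 + ∑ i, g i (a i + (∑ k, D k) i) := by
  have hK' : (K : ℝ) ≠ 0 := Nat.cast_ne_zero.mpr hK
  rw [← sum_sum_of_partition hdisj hcover]
  simp only [locF, Finset.sum_add_distrib, mulVecE_eq_toLpLin, map_sum, inner_sum,
    Finset.mul_sum]
  congr 1
  · simp [hK']
  · refine Finset.sum_congr rfl fun k _ => Finset.sum_congr rfl fun i hi => ?_
    rw [sum_apply_of_mem hdisj hD hi]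

theorem sum_locF_zero (hK : K ≠ 0) (hdisj : ∀ k l, k ≠ l → Disjoint (I k) (I l))
    (hcover : ∀ i, ∃ k, i ∈ I k) (a : EuclideanSpace ℝ (Fin n)) :
    ∑ k, locF A f f' g K σ β (I k) a 0 = objF A f g a := by
  rw [sum_locF hK hdisj hcover a (D := fun _ => 0) (by simp)]
  simp [objF, mulVecE_eq_toLpLin]

/-- The sum of the local objectives majorizes the global objective. -/
theorem objF_add_sum_le (hK : K ≠ 0) (hβ : 0 < β)
    (hsmooth : ∀ u w : EuclideanSpace ℝ (Fin d),
      f w ≤ f u + ⟪f' u, w - u⟫ + β / 2 * ‖w - u‖ ^ 2)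
    (hdisj : ∀ k l, k ≠ l → Disjoint (I k) (I l)) (hcover : ∀ i, ∃ k, i ∈ I k)
    (hcompat : ∀ x : EuclideanSpace ℝ (Fin n),
      ‖mulVecE A x‖ ^ 2 ≤ σ * ∑ k, ‖mulVecE A (restr (I k) x)‖ ^ 2)
    (a : EuclideanSpace ℝ (Fin n))
    {D : Fin K → EuclideanSpace ℝ (Fin n)} (hD : ∀ k, ∀ i ∉ I k, D k i = 0) :
    objF A f g (a + ∑ k, D k) ≤ ∑ k, locF A f f' g K σ β (I k) a (D k) := by
  rw [sum_locF hK hdisj hcover a hD, objF]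
  have hc := hcompat (∑ k, D k)
  simp_rw [restr_sum hdisj hD] at hc
  have hs := hsmooth (mulVecE A a) (mulVecE A (a + ∑ k, D k))
  have hsub : mulVecE A (a + ∑ k, D k) - mulVecE A a = mulVecE A (∑ k, D k) := by
    simp [mulVecE_eq_toLpLin]
  rw [hsub] at hs
  have hq := mul_le_mul_of_nonneg_left hc (half_pos hβ).le
  simp only [PiLp.add_apply]
  linarith

theorem bddBelow_locF_image (hK : K ≠ 0) (hβ : 0 < β)
    (hsmooth : ∀ u w : EuclideanSpace ℝ (Fin d),
      f w ≤ f u + ⟪f' u, w - u⟫ + β / 2 * ‖w - u‖ ^ 2)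
    (hdisj : ∀ k l, k ≠ l → Disjoint (I k) (I l)) (hcover : ∀ i, ∃ k, i ∈ I k)
    (hcompat : ∀ x : EuclideanSpace ℝ (Fin n),
      ‖mulVecE A x‖ ^ 2 ≤ σ * ∑ k, ‖mulVecE A (restr (I k) x)‖ ^ 2)
    {m : ℝ} (hm : ∀ x, m ≤ objF A f g x) (a : EuclideanSpace ℝ (Fin n)) (k : Fin K) :
    BddBelow (locF A f f' g K σ β (I k) a '' {Δ | ∀ i ∉ I k, Δ i = 0}) := by
  refine ⟨m - ∑ l ∈ Finset.univ.erase k, locF A f f' g K σ β (I l) a 0, ?_⟩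
  rintro _ ⟨Δ, hΔ, rfl⟩
  have hD : ∀ l, ∀ i ∉ I l,
      (Pi.single k Δ : Fin K → EuclideanSpace ℝ (Fin n)) l i = 0 := by
    intro l i hi
    obtain rfl | hl := eq_or_ne l k
    · simpa using hΔ i hi
    · simp [hl]
  have h := objF_add_sum_le (g := g) hK hβ hsmooth hdisj hcover hcompat a hD
  rw [← Finset.add_sum_erase _ _ (Finset.mem_univ k), Pi.single_eq_same] at h
  have hrest : ∑ l ∈ Finset.univ.erase k, locF A f f' g K σ β (I l) a
      ((Pi.single k Δ : Fin K → EuclideanSpace ℝ (Fin n)) l) =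
      ∑ l ∈ Finset.univ.erase k, locF A f f' g K σ β (I l) a 0 :=
    Finset.sum_congr rfl fun l hl => by rw [Pi.single_eq_of_ne (Finset.ne_of_mem_erase hl)]
  rw [← Finset.add_sum_erase _ _ (Finset.mem_univ k), Pi.single_eq_same, hrest] at h
  linarith [(hm _).trans h]

/-- Moving a fraction `μ / (μ + σ β c_A)` of the way along `u` in every block decreases the
local objectives proportionally to the decrease of the global objective. -/
theorem sum_locF_smul_restr_le (hK : K ≠ 0) (hβ : 0 < β)
    (hconvf : ConvexOn ℝ Set.univ f) (hgrad : ∀ u, HasGradientAt f (f' u) u)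
    (hμ : 0 < μ) (hg : ∀ i, StrongConvexOn Set.univ μ (g i))
    (hdisj : ∀ k l, k ≠ l → Disjoint (I k) (I l)) (hcover : ∀ i, ∃ k, i ∈ I k)
    (hσ : 0 < σ) (hcA : 0 < cA)
    (hAbound : ∀ x : EuclideanSpace ℝ (Fin n), ‖mulVecE A x‖ ^ 2 ≤ cA * ‖x‖ ^ 2)
    (a u : EuclideanSpace ℝ (Fin n)) {s : ℝ} (hs : s = μ / (μ + σ * β * cA)) :
    ∑ k, locF A f f' g K σ β (I k) a (s • restr (I k) u) ≤
      (1 - s) * objF A f g a + s * objF A f g (a + u) := by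
  have hp : 0 < σ * β * cA := by positivity
  have hs0 : 0 ≤ s := by rw [hs]; positivity
  have hs1 : s ≤ 1 := by rw [hs, div_le_one (by positivity)]; linarith
  have hseq : s * (σ * β * cA) = (1 - s) * μ := by rw [hs]; field_simp; ring
  rw [sum_locF hK hdisj hcover a fun k i hi => by simp [restr_apply, hi], ← Finset.smul_sum,
    sum_restr hdisj hcover]
  have hquad : ∑ k, ‖mulVecE A (s • restr (I k) u)‖ ^ 2 ≤ s ^ 2 * (cA * ‖u‖ ^ 2) := by
    rw [← sum_norm_sq_restr hdisj hcover u, Finset.mul_sum, Finset.mul_sum]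
    refine Finset.sum_le_sum fun k _ => ?_
    have hlin : mulVecE A (s • restr (I k) u) = s • mulVecE A (restr (I k) u) := by
      simp only [mulVecE_eq_toLpLin, map_smul]
    rw [hlin, norm_smul, mul_pow, Real.norm_eq_abs, sq_abs]
    exact mul_le_mul_of_nonneg_left (hAbound _) (sq_nonneg s)
  have hlin : ⟪f' (mulVecE A a), mulVecE A (s • u)⟫ =
      s * ⟪f' (mulVecE A a), mulVecE A u⟫ := by
    simp only [mulVecE_eq_toLpLin, map_smul, inner_smul_right]
  have hfirst := hconvf.add_inner_gradient_le (hgrad (mulVecE A a)) (mulVecE A (a + u))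
  have hsub : mulVecE A (a + u) - mulVecE A a = mulVecE A u := by
    simp [mulVecE_eq_toLpLin]
  rw [hsub] at hfirst
  have hreg : ∑ i, g i (a i + (s • u) i) ≤
      (1 - s) * ∑ i, g i (a i) + s * ∑ i, g i ((a + u) i)
        - (1 - s) * s * (μ / 2 * ‖u‖ ^ 2) := by
    rw [EuclideanSpace.real_norm_sq_eq, Finset.mul_sum, Finset.mul_sum, Finset.mul_sum,
      Finset.mul_sum, ← Finset.sum_add_distrib, ← Finset.sum_sub_distrib]
    refine Finset.sum_le_sum fun i _ => ?_
    have h := (hg i).2 (Set.mem_univ (a i)) (Set.mem_univ (a i + u i)) (sub_nonneg.mpr hs1) hs0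
      (sub_add_cancel 1 s)
    have harg : (1 - s) • a i + s • (a i + u i) = a i + s * u i := by
      simp only [smul_eq_mul]; ring
    have hnorm : ‖a i - (a i + u i)‖ ^ 2 = u i ^ 2 := by
      rw [Real.norm_eq_abs, sq_abs]; ring
    beta_reduce at h
    rw [harg, hnorm] at h
    simpa using h
  have hq := mul_le_mul_of_nonneg_left hquad (by positivity : 0 ≤ σ * β / 2)
  have hbal : σ * β / 2 * (s ^ 2 * (cA * ‖u‖ ^ 2)) = (1 - s) * s * (μ / 2 * ‖u‖ ^ 2) := by
    linear_combination s * ‖u‖ ^ 2 / 2 * hseq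
  have hf := mul_le_mul_of_nonneg_left hfirst hs0
  rw [hlin]
  simp only [objF]
  linarith

end CoCoA

/-- Theorem 1 of the paper, linear convergence of CoCoA for strongly
convex regularizers. A CoCoA sequence with approximation quality θ satisfies
`ε^(t) ≤ (1 − (1−θ)·μ/(μ + σβc_A))^t · ε^(0)`. -/
theorem stmt_3 {d n K : ℕ} (A : Matrix (Fin d) (Fin n) ℝ)
    (f : EuclideanSpace ℝ (Fin d) → ℝ)
    (f' : EuclideanSpace ℝ (Fin d) → EuclideanSpace ℝ (Fin d))
    (β : ℝ) (hβ : 0 < β)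
    (hconvf : ConvexOn ℝ Set.univ f)
    (hgrad : ∀ u, HasGradientAt f (f' u) u)
    (hsmooth : ∀ u w : EuclideanSpace ℝ (Fin d),
      f w ≤ f u + ⟪f' u, w - u⟫ + β / 2 * ‖w - u‖ ^ 2)
    (g : Fin n → ℝ → ℝ) (μ : ℝ) (hμ : 0 < μ)
    (hg : ∀ i, StrongConvexOn Set.univ μ (g i))
    (I : Fin K → Finset (Fin n))
    (hne : ∀ k, (I k).Nonempty)
    (hdisj : ∀ k l, k ≠ l → Disjoint (I k) (I l))
    (hcover : ∀ i, ∃ k, i ∈ I k)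
    (σ : ℝ) (hσ : 0 < σ)
    (hcompat : ∀ x : EuclideanSpace ℝ (Fin n),
      ‖mulVecE A x‖ ^ 2 ≤ σ * ∑ k, ‖mulVecE A (restr (I k) x)‖ ^ 2)
    (cA : ℝ) (hcA : 0 < cA)
    (hAbound : ∀ x : EuclideanSpace ℝ (Fin n), ‖mulVecE A x‖ ^ 2 ≤ cA * ‖x‖ ^ 2)
    (αstar : EuclideanSpace ℝ (Fin n))
    (hmin : ∀ x : EuclideanSpace ℝ (Fin n), objF A f g αstar ≤ objF A f g x)
    (θ : ℝ) (hθ : θ ∈ Set.Ioc (0 : ℝ) 1)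
    (α : ℕ → EuclideanSpace ℝ (Fin n)) (Δ : ℕ → Fin K → EuclideanSpace ℝ (Fin n))
    (happrox : ∀ t k, IsApprox A f f' g K σ β θ (I k) (α t) (Δ t k))
    (hstep : ∀ t, α (t + 1) = α t + ∑ k, Δ t k) :
    ∀ t : ℕ, objF A f g (α t) - objF A f g αstar ≤
      (1 - (1 - θ) * (μ / (μ + σ * β * cA))) ^ t *
        (objF A f g (α 0) - objF A f g αstar) := by
  intro t
  rcases Nat.eq_zero_or_pos K with rfl | hKpos
  · have hempty : IsEmpty (Fin n) := ⟨fun i => (hcover i).choose.elim0⟩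
    have hsub : ∀ x y : EuclideanSpace ℝ (Fin n), x = y := fun x y => by
      ext i
      exact hempty.elim i
    simp [hsub (α t) αstar, hsub (α 0) αstar]
  have hK : K ≠ 0 := hKpos.ne'
  obtain ⟨s, hs⟩ : ∃ s, s = μ / (μ + σ * β * cA) := ⟨_, rfl⟩
  have hp : 0 < σ * β * cA := by positivity
  have hs0 : 0 ≤ s := by rw [hs]; positivity
  have hs1 : s ≤ 1 := by rw [hs, div_le_one (by positivity)]; linarith
  rw [← hs]
  have hrate : 0 ≤ 1 - (1 - θ) * s := by nlinarith [hθ.1, hθ.2]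
  induction t with
  | zero => simp
  | succ t ih =>
    have hmajor := objF_add_sum_le (g := g) hK hβ hsmooth hdisj hcover hcompat (α t)
      fun k => (happrox t k).1
    have hlocal : ∀ k, locF A f f' g K σ β (I k) (α t) (Δ t k) ≤
        θ * locF A f f' g K σ β (I k) (α t) 0 + (1 - θ) *
          locF A f f' g K σ β (I k) (α t) (s • restr (I k) (αstar - α t)) := by
      intro k
      have hinf : locInf A f f' g K σ β (I k) (α t) ≤
          locF A f f' g K σ β (I k) (α t) (s • restr (I k) (αstar - α t)) :=
        csInf_le (bddBelow_locF_image hK hβ hsmooth hdisj hcover hcompat hmin (α t) k)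
          ⟨_, fun i hi => by simp [restr_apply, hi], rfl⟩
      have := mul_le_mul_of_nonneg_left hinf (sub_nonneg.mpr hθ.2)
      linarith [(happrox t k).2]
    have hsum := Finset.sum_le_sum fun k (_ : k ∈ Finset.univ) => hlocal k
    rw [Finset.sum_add_distrib, ← Finset.mul_sum, ← Finset.mul_sum,
      sum_locF_zero hK hdisj hcover] at hsum
    have hdecr := mul_le_mul_of_nonneg_left
      (sum_locF_smul_restr_le hK hβ hconvf hgrad hμ hg hdisj hcover hσ hcA hAbound
        (α t) (αstar - α t) hs) (sub_nonneg.mpr hθ.2)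
    rw [add_sub_cancel] at hdecr
    rw [hstep t, pow_succ', mul_assoc]
    have hcontract := mul_le_mul_of_nonneg_left ih hrate
    linarith
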